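/- There exist constants n_0, c > 0 and C such that the following holds for every function f : ℝ → ℝ. Let n ≥ n_0 be an integer and let m ≥ 1 and λ ≥ 1 be real numbers with λ m ≤ √n and λ ≤ c√n/20. If S(n, m, ε, Γ) holds (for Q_n, q_n, f) for some reals ε > 0 and Γ ≥ 1, then S(n, 1, ε', Γ') holds for every ε' ≥ ε + Γ η and every Γ' ≥ Γ (1 + η), where η = C·(e^{−c λ²} + λ m/√n + n e^{−c n}). -/

import Mathlib

open MeasureTheory ProbabilityTheory

/-- Binary convolution of laws on `ℤ` (the law of the sum of independent variables). -/
noncomputable def mconvZ (μ ν : Measure ℤ) : Measure ℤ :=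
  μ.bind (fun x => ν.map (fun y => x + y))

/-- `μ n` is the law of `Q_n`, the number of key comparisons used by QuickSort on `n` keys. -/
def IsQuicksortLaw (μ : ℕ → Measure ℤ) : Prop :=
  (∀ n, IsProbabilityMeasure (μ n)) ∧
  μ 0 = Measure.dirac 0 ∧ μ 1 = Measure.dirac 0 ∧
  ∀ n : ℕ, 2 ≤ n →
    μ n = (n : ENNReal)⁻¹ •
      ∑ u ∈ Finset.Icc 1 n,
        (mconvZ (μ (u - 1)) (μ (n - u))).map (fun x => x + ((n : ℤ) - 1))

/-- The mean `q_n = E Q_n` of a law on `ℤ`. -/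
noncomputable def meanZ (ν : Measure ℤ) : ℝ := ∫ k, (k : ℝ) ∂ν

/-- The smoothness statement `S(n, m, ε, Γ)` for the law `μn` of `Q_n` (with mean `qn`)
and density `f`:  (i) every half-open interval `I` of length `m` containing `q_n + n x`
has `|P(Q_n ∈ I) − (m/n) f(x)| ≤ ε m/n`;  (ii) every half-open interval of length `m` has
`P(Q_n ∈ I) ≤ Γ m/n`. -/
def Sprop (μn : Measure ℤ) (qn : ℝ) (n : ℕ) (f : ℝ → ℝ) (m ε Γ : ℝ) : Prop :=
  (∀ a x : ℝ, qn + (n : ℝ) * x ∈ Set.Ioc a (a + m) →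
    |(μn {k : ℤ | (k : ℝ) ∈ Set.Ioc a (a + m)}).toReal - (m / n) * f x| ≤ ε * m / n) ∧
  (∀ a : ℝ, (μn {k : ℤ | (k : ℝ) ∈ Set.Ioc a (a + m)}).toReal ≤ Γ * m / n)

/-- The probability that a sum of `N` fair coins equals `j`. -/
noncomputable def fairBinom : ℕ → ℤ → ℝ
  | 0, j => if j = 0 then 1 else 0
  | N + 1, j => (fairBinom N j + fairBinom N (j - 1)) / 2

lemma fairBinom_nonneg (N : ℕ) (j : ℤ) : 0 ≤ fairBinom N j := by
  induction N generalizing j with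
  | zero => unfold fairBinom; split_ifs <;> norm_num
  | succ N ih =>
    have := ih j
    have := ih (j - 1)
    unfold fairBinom
    positivity

lemma fairBinom_le_one (N : ℕ) (j : ℤ) : fairBinom N j ≤ 1 := by
  induction N generalizing j with
  | zero => unfold fairBinom; split_ifs <;> norm_num
  | succ N ih =>
    have := ih j
    have := ih (j - 1)
    unfold fairBinom
    linarith

lemma fairBinom_eq_zero_of_lt {N : ℕ} {j : ℤ} (h : (N : ℤ) < j) : fairBinom N j = 0 := by
  induction N generalizing j with
  | zero => unfold fairBinom; exact if_neg (by push_cast at h; omega)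
  | succ N ih =>
    push_cast at h
    unfold fairBinom
    rw [ih (by omega), ih (by omega)]
    norm_num

lemma fairBinom_symm (N : ℕ) (j : ℤ) : fairBinom N (N - j) = fairBinom N j := by
  induction N generalizing j with
  | zero => simp [fairBinom]
  | succ N ih =>
    unfold fairBinom
    have h1 := ih (j - 1)
    have h2 := ih j
    push_cast
    rw [← h1, ← h2, add_comm]
    congr 3 <;> ring

lemma fairBinom_succ_mul (N : ℕ) (j : ℤ) :
    ((j : ℝ) + 1) * fairBinom N (j + 1) = (N - j) * fairBinom N j := by
  induction N generalizing j with
  | zero =>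
    unfold fairBinom
    rcases eq_or_ne j 0 with rfl | h0
    · simp
    · rcases eq_or_ne j (-1) with rfl | h1
      · simp
      · rw [if_neg h0, if_neg (by omega)]; simp
  | succ N ih =>
    have h1 := ih j
    have h2 := ih (j - 1)
    rw [sub_add_cancel] at h2
    push_cast at h2
    unfold fairBinom
    rw [add_sub_cancel_right]
    push_cast
    linear_combination (1 / 2) * h1 + (1 / 2) * h2

/-- Beyond `E` above the centre the binomial weights decay geometrically. -/
lemma fairBinom_tail_step {N : ℕ} {n E : ℝ} (hn : 0 < n) (hN : N ≤ n) (hE : 0 ≤ E) {i : ℤ}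
    (hi : (N : ℝ) / 2 + E ≤ i) :
    fairBinom N (i + 1) ≤ Real.exp (-(2 * E / n)) * fairBinom N i := by
  have hb := fairBinom_nonneg N i
  rcases lt_or_ge i (N : ℤ) with h | h
  · have hiN : (i : ℝ) + 1 ≤ N := by exact_mod_cast h
    have hN0 : (0 : ℝ) ≤ N := Nat.cast_nonneg N
    have hpos : (0 : ℝ) < i + 1 := by linarith
    have hexp := Real.add_one_le_exp (-(2 * E / n))
    have hq : 2 * E / n * (i + 1) ≤ 2 * E := by
      rw [div_mul_eq_mul_div, div_le_iff₀ hn]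
      gcongr
      linarith
    have h1 : (N - i : ℝ) ≤ Real.exp (-(2 * E / n)) * (i + 1) := by
      calc (N - i : ℝ) ≤ (-(2 * E / n) + 1) * (i + 1) := by linarith
        _ ≤ _ := by gcongr
    have h2 := mul_le_mul_of_nonneg_right h1 hb
    rw [← fairBinom_succ_mul] at h2
    refine le_of_mul_le_mul_left (h2.trans_eq ?_) hpos
    ring
  · rw [fairBinom_eq_zero_of_lt (by omega)]
    positivity

lemma fairBinom_tail {N : ℕ} {n E : ℝ} (hn : 0 < n) (hN : N ≤ n) (hE : 0 ≤ E) {i : ℤ}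
    (hi : (N : ℝ) / 2 + E ≤ i) (s : ℕ) :
    fairBinom N (i + s) ≤ Real.exp (-(2 * E / n) * s) * fairBinom N i := by
  induction s with
  | zero => simp
  | succ s ih =>
    have h := fairBinom_tail_step hn hN hE (i := i + s) (by
      have : (0 : ℝ) ≤ s := Nat.cast_nonneg s
      push_cast
      linarith)
    calc fairBinom N (i + (s + 1 : ℕ)) = fairBinom N (i + s + 1) := by push_cast; ring_nf
      _ ≤ _ := h
      _ ≤ Real.exp (-(2 * E / n)) * (Real.exp (-(2 * E / n) * s) * fairBinom N i) := by gcongr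
      _ = _ := by rw [← mul_assoc, ← Real.exp_add]; push_cast; ring_nf

/-- Near the centre the binomial weights vary slowly. -/
lemma fairBinom_central {N : ℕ} {R x : ℝ} {i : ℤ} (t : ℕ) (hx : 0 ≤ x) (hR : R < N)
    (hi : i + t ≤ R) (hx' : 2 * R + 1 - N ≤ x * (N - R)) :
    fairBinom N i ≤ Real.exp (x * t) * fairBinom N (i + t) := by
  induction t with
  | zero => simp
  | succ t ih =>
    push_cast at hi
    have ih := ih (by linarith)
    have hb := fairBinom_nonneg N (i + t + 1)
    have hpos : (0 : ℝ) < N - (i + t) := by linarith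
    have hexp := Real.add_one_le_exp x
    have h1 : (i + t + 1 : ℝ) ≤ Real.exp x * (N - (i + t)) := by
      calc (i + t + 1 : ℝ) ≤ (x + 1) * (N - (i + t)) := by nlinarith
        _ ≤ _ := by gcongr
    have h2 := mul_le_mul_of_nonneg_right h1 hb
    have h3 := fairBinom_succ_mul N (i + t)
    push_cast at h3
    rw [h3] at h2
    have h4 : fairBinom N (i + t) ≤ Real.exp x * fairBinom N (i + t + 1) :=
      le_of_mul_le_mul_left (h2.trans_eq (by ring)) hpos
    calc fairBinom N i ≤ _ := ih
      _ ≤ Real.exp (x * t) * (Real.exp x * fairBinom N (i + t + 1)) := by gcongr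
      _ = _ := by rw [← mul_assoc, ← Real.exp_add]; push_cast; ring_nf

lemma fairBinom_smooth {n N s : ℕ} {m l : ℝ} (hn : 1000000 ≤ n) (hNn : N ≤ n)
    (hN : (n : ℝ) / 50 ≤ N) (hm : 1 ≤ m) (hl : 1 ≤ l) (hlm : l * m ≤ √n)
    (hln : l ≤ √n / 4000) (hs1 : l * √n ≤ s) (hs2 : s ≤ 4 * (l * √n)) {t : ℤ} (ht : |(t : ℝ)| ≤ m)
    (j : ℤ) :
    fairBinom N j ≤ Real.exp (3000 * (l * m / √n)) * fairBinom N (j + t) +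
      Real.exp (-l ^ 2) * (fairBinom N (j - s) + fairBinom N (j + s)) := by
  have hn' : (1000000 : ℝ) ≤ n := by exact_mod_cast hn
  have hNn' : (N : ℝ) ≤ n := by exact_mod_cast hNn
  have hn0 : (0 : ℝ) < n := by linarith
  have hq : 1000 ≤ √(n : ℝ) := by
    apply Real.le_sqrt_of_sq_le
    norm_num
    exact_mod_cast hn
  have hqq : √(n : ℝ) * √n = n := Real.mul_self_sqrt hn0.le
  set q := √(n : ℝ)
  have hq0 : 0 < q := by linarith
  have hmq : m ≤ q := by nlinarith
  have hlq : l * q ≤ n / 4000 := by rw [← hqq]; nlinarith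
  have hqlq : q ≤ l * q := by nlinarith
  have hqn : q ≤ n / 1000 := by rw [← hqq]; nlinarith
  have right : ∀ i : ℤ, (N : ℝ) / 2 + 8 * (l * q) < i →
      fairBinom N i ≤ Real.exp (-l ^ 2) * fairBinom N (i - s) := by
    intro i hi
    have h := fairBinom_tail (i := i - s) hn0 hNn' (E := 4 * (l * q)) (by positivity)
      (by push_cast; linarith) s
    rw [sub_add_cancel] at h
    refine h.trans ?_
    have := fairBinom_nonneg N (i - s)
    gcongr
    rw [neg_mul, neg_le_neg_iff, div_mul_eq_mul_div, le_div_iff₀ hn0, ← hqq]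
    have : 0 < l * q := by positivity
    nlinarith
  have central : ∀ (i : ℤ) (t : ℕ), (t : ℝ) ≤ m → (i : ℝ) ≤ N / 2 + 8 * (l * q) →
      fairBinom N i ≤ Real.exp (3000 * (l * m / q)) * fairBinom N (i + t) := by
    intro i t ht hi
    have hx : 3000 * (l / q) * (7 * n / 1000) = 21 * (l * q) := by
      rw [← hqq]; field_simp; norm_num
    have h0 : (0 : ℝ) ≤ 3000 * (l / q) := by positivity
    have h := fairBinom_central (N := N) (R := N / 2 + 8 * (l * q) + m) (x := 3000 * (l / q))
      (i := i) t h0 (by linarith) (by linarith) (by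
        refine le_trans ?_ (mul_le_mul_of_nonneg_left (a := 3000 * (l / q))
          (b := 7 * n / 1000) ?_ h0)
        · rw [hx]; linarith
        · linarith)
    refine h.trans ?_
    have := fairBinom_nonneg N (i + t)
    rw [mul_div_right_comm, ← mul_assoc]
    gcongr
  have hb1 := fairBinom_nonneg N (j - s)
  have hb2 := fairBinom_nonneg N (j + s)
  have hb3 := fairBinom_nonneg N (j + t)
  have e1 := Real.exp_pos (-l ^ 2)
  have e2 := Real.exp_pos (3000 * (l * m / q))
  rcases lt_or_ge ((N : ℝ) / 2 + 8 * (l * q)) j with h | h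
  · have := right j h
    nlinarith [mul_nonneg e1.le hb2, mul_nonneg e2.le hb3]
  rcases lt_or_ge ((N : ℝ) / 2 + 8 * (l * q)) ((N - j : ℤ) : ℝ) with h' | h'
  · have := right _ h'
    rw [fairBinom_symm, sub_sub, fairBinom_symm] at this
    nlinarith [mul_nonneg e1.le hb1, mul_nonneg e2.le hb3]
  have key : fairBinom N j ≤ Real.exp (3000 * (l * m / q)) * fairBinom N (j + t) := by
    rcases le_total 0 t with h0 | h0
    · obtain ⟨t, rfl⟩ := Int.eq_ofNat_of_zero_le h0
      exact central j t (by simpa using ht) h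
    · obtain ⟨u, hu⟩ := Int.eq_ofNat_of_zero_le (neg_nonneg.2 h0)
      obtain rfl : t = -u := by omega
      have := central (N - j) u (by simpa using ht) h'
      rwa [fairBinom_symm, show (N : ℤ) - j + u = N - (j + -u) by ring, fairBinom_symm] at this
  nlinarith [mul_nonneg e1.le hb1, mul_nonneg e1.le hb2]

open AddMonoidAlgebra in
/-- The joint law of `(N, R)` in a decomposition `Q_n = R + B` in which `B` is, given `(N, R)`,
a sum of `N` fair coins: every sublist of length three whose pivot is extreme in one half of the
cases counts as a coin. -/
noncomputable def coinLaw : ℕ → AddMonoidAlgebra ℝ (ℕ × ℤ)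
  | 0 => 1
  | 1 => 1
  | 2 => single (0, 1) 1
  | 3 => single (1, 2) (2 / 3) + single (0, 3) (1 / 3)
  | n + 4 => ((n + 4 : ℕ) : ℝ)⁻¹ • ∑ u : Fin (n + 4),
      single (0, (n + 3 : ℤ)) 1 * (coinLaw u * coinLaw (n + 3 - u))
  termination_by n => n
  decreasing_by all_goals omega

lemma coinLaw_succ {n : ℕ} (hn : 3 ≤ n) :
    coinLaw (n + 1) = ((n + 1 : ℕ) : ℝ)⁻¹ • ∑ u ∈ Finset.range (n + 1),
      AddMonoidAlgebra.single (0, (n : ℤ)) 1 * (coinLaw u * coinLaw (n - u)) := by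
  obtain ⟨n, rfl⟩ := Nat.exists_eq_add_of_le' hn
  rw [coinLaw, Finset.sum_range]
  push_cast
  rw [show ((n : ℝ) + 3 + 1) = n + 4 by ring]

/-- The law of `R + B` as an element of the Laurent polynomial algebra. -/
noncomputable def tossCoins : AddMonoidAlgebra ℝ (ℕ × ℤ) →ₐ[ℝ] AddMonoidAlgebra ℝ ℤ :=
  AddMonoidAlgebra.lift ℝ (AddMonoidAlgebra ℝ ℤ) (ℕ × ℤ)
    { toFun := fun x => (AddMonoidAlgebra.single 0 (1 / 2) + AddMonoidAlgebra.single 1 (1 / 2)) ^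
        x.toAdd.1 * AddMonoidAlgebra.single x.toAdd.2 1
      map_one' := by
        rw [toAdd_one, Prod.fst_zero, Prod.snd_zero, pow_zero, one_mul, AddMonoidAlgebra.one_def]
      map_mul' := fun x y => by
        rw [toAdd_mul, Prod.fst_add, Prod.snd_add, pow_add,
          ← one_mul (1 : ℝ), ← AddMonoidAlgebra.single_mul_single, one_mul]
        ring }

lemma tossCoins_single (N : ℕ) (r : ℤ) (w : ℝ) :
    tossCoins (AddMonoidAlgebra.single (N, r) w) =
      w • ((AddMonoidAlgebra.single 0 (1 / 2) + AddMonoidAlgebra.single 1 (1 / 2)) ^ N *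
        AddMonoidAlgebra.single r 1) := by
  rw [tossCoins, AddMonoidAlgebra.lift_single]
  rfl

lemma coeff_coin_pow (N : ℕ) (j : ℤ) :
    ((AddMonoidAlgebra.single (0 : ℤ) (1 / 2 : ℝ) + AddMonoidAlgebra.single 1 (1 / 2)) ^ N).coeff j
      = fairBinom N j := by
  induction N generalizing j with
  | zero =>
    rw [pow_zero, AddMonoidAlgebra.one_def, AddMonoidAlgebra.coeff_single, Finsupp.single_apply,
      fairBinom]
    simp only [eq_comm]
  | succ N ih =>
    rw [pow_succ, mul_add, AddMonoidAlgebra.coeff_add, Finsupp.add_apply,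
      AddMonoidAlgebra.coeff_mul_single_eq_coeff_mul (m := 0) j (by simp),
      AddMonoidAlgebra.coeff_mul_single_eq_coeff_mul (m := 1) (j - 1)
        (fun _ _ => eq_sub_iff_add_eq.symm), ih, ih, fairBinom]
    ring

lemma coeff_tossCoins (W : AddMonoidAlgebra ℝ (ℕ × ℤ)) (k : ℤ) :
    (tossCoins W).coeff k =
      ∑ i ∈ W.coeff.support, W.coeff i * fairBinom i.1 (k - i.2) := by
  conv_lhs => rw [← AddMonoidAlgebra.sum_coeff_single W]
  rw [Finsupp.sum, map_sum, AddMonoidAlgebra.coeff_sum, Finsupp.finsetSum_apply]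
  refine Finset.sum_congr rfl fun i _ => ?_
  rw [tossCoins_single, AddMonoidAlgebra.coeff_smul_apply,
    AddMonoidAlgebra.coeff_mul_single_eq_coeff_mul (m := i.2) (k - i.2)
      (fun _ _ => eq_sub_iff_add_eq.symm), coeff_coin_pow, smul_eq_mul, mul_one]

lemma coeff_mul_int (p q : AddMonoidAlgebra ℝ ℤ) (k : ℤ) :
    (p * q).coeff k = ∑ x ∈ p.coeff.support, p.coeff x * q.coeff (k - x) := by
  conv_lhs => rw [← AddMonoidAlgebra.sum_coeff_single p]
  rw [Finsupp.sum, Finset.sum_mul, AddMonoidAlgebra.coeff_sum, Finsupp.finsetSum_apply]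
  refine Finset.sum_congr rfl fun i _ => ?_
  rw [AddMonoidAlgebra.coeff_single_mul_eq_mul_coeff (m := i) (k - i)
      (fun _ _ => by rw [eq_sub_iff_add_eq, add_comm])]

lemma tossCoins_coinLaw_succ {n : ℕ} (hn : 1 ≤ n) :
    tossCoins (coinLaw (n + 1)) = ((n + 1 : ℕ) : ℝ)⁻¹ • ∑ u ∈ Finset.range (n + 1),
      (tossCoins (coinLaw u) * tossCoins (coinLaw (n - u)) * AddMonoidAlgebra.single (n : ℤ) 1) := by
  rcases (by omega : n = 1 ∨ n = 2 ∨ 3 ≤ n) with rfl | rfl | h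
  · rw [Finset.sum_range_succ, Finset.sum_range_one]
    rw [tsub_zero, tsub_self, coinLaw, coinLaw, coinLaw, tossCoins_single, map_one, mul_one,
      one_mul, pow_zero, one_mul]
    push_cast
    rw [← two_smul ℝ, smul_smul]
    norm_num
  · rw [Finset.sum_range_succ, Finset.sum_range_succ, Finset.sum_range_one]
    rw [tsub_zero, tsub_self, Nat.add_one_sub_one, coinLaw, coinLaw, coinLaw, coinLaw, map_add,
      tossCoins_single, tossCoins_single, tossCoins_single, map_one, mul_one, one_mul, pow_zero,
      pow_one, one_mul, one_mul, one_mul, add_mul, AddMonoidAlgebra.single_mul_single,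
      AddMonoidAlgebra.single_mul_single, one_smul,
      mul_one (AddMonoidAlgebra.single (1 : ℤ) (1 : ℝ)), AddMonoidAlgebra.single_mul_single]
    ext k
    simp only [AddMonoidAlgebra.coeff_add, AddMonoidAlgebra.coeff_smul,
      AddMonoidAlgebra.coeff_single, Finsupp.add_apply, Finsupp.smul_apply, Finsupp.single_apply,
      smul_eq_mul]
    norm_num
    split_ifs <;> norm_num
  · rw [coinLaw_succ h, map_smul, map_sum]
    congr 1
    refine Finset.sum_congr rfl fun u _ => ?_
    rw [map_mul, map_mul, tossCoins_single]
    rw [pow_zero, one_mul, one_smul, mul_comm]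

lemma measureReal_mconvZ {μ ν : Measure ℤ} [IsProbabilityMeasure μ] [IsProbabilityMeasure ν]
    {p q : AddMonoidAlgebra ℝ ℤ} (hp : ∀ k, μ.real {k} = p.coeff k)
    (hq : ∀ k, ν.real {k} = q.coeff k) (k : ℤ) : (mconvZ μ ν).real {k} = (p * q).coeff k := by
  have h1 : mconvZ μ ν {k} = ∑' x, ν {k - x} * μ {x} := by
    rw [mconvZ, Measure.bind_apply (.singleton k) (measurable_of_countable _).aemeasurable,
      lintegral_countable']
    congr! 3 with x
    rw [Measure.map_apply (measurable_of_countable _) (.singleton k)]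
    congr 1
    ext y
    rw [Set.mem_preimage, Set.mem_singleton_iff, Set.mem_singleton_iff, eq_sub_iff_add_eq,
      add_comm]
  have h2 : ∀ x ∉ p.coeff.support, ν {k - x} * μ {x} = 0 := by
    intro x hx
    have : μ.real {x} = 0 := by rw [hp]; simpa using hx
    rw [measureReal_eq_zero_iff] at this
    rw [this, mul_zero]
  rw [measureReal_def, h1, tsum_eq_sum h2, ENNReal.toReal_sum
    (fun x _ => ENNReal.mul_ne_top (measure_ne_top _ _) (measure_ne_top _ _)), coeff_mul_int]
  refine Finset.sum_congr rfl fun x _ => ?_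
  rw [ENNReal.toReal_mul, ← measureReal_def, ← measureReal_def, hp, hq, mul_comm]

lemma measureReal_quicksortLaw {μ : ℕ → Measure ℤ} (hμ : IsQuicksortLaw μ) (n : ℕ) (k : ℤ) :
    (μ n).real {k} = (tossCoins (coinLaw n)).coeff k := by
  obtain ⟨hprob, h0, h1, hrec⟩ := hμ
  induction n using Nat.strong_induction_on generalizing k with
  | _ n ih =>
  have base : ∀ k : ℤ, (Measure.dirac (0 : ℤ)).real {k} =
      (1 : AddMonoidAlgebra ℝ ℤ).coeff k := by
    intro k
    rw [measureReal_def, Measure.dirac_apply, Set.indicator_apply, AddMonoidAlgebra.one_def,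
      AddMonoidAlgebra.coeff_single, Finsupp.single_apply]
    simp only [Set.mem_singleton_iff]
    split_ifs <;> simp
  rcases (by omega : n = 0 ∨ n = 1 ∨ (1 ≤ n - 1 ∧ n = n - 1 + 1)) with rfl | rfl | ⟨hm, hn⟩
  · rw [h0, coinLaw, map_one, base]
  · rw [h1, coinLaw, map_one, base]
  obtain ⟨m, rfl⟩ : ∃ m, n = m + 1 := ⟨_, hn⟩
  rw [Nat.add_sub_cancel] at hm
  have hfin : ∀ u ∈ Finset.range (m + 1),
      (Measure.map (fun x => x + (m : ℤ)) (mconvZ (μ u) (μ (m - u)))).real {k} =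
        (tossCoins (coinLaw u) * tossCoins (coinLaw (m - u)) *
          AddMonoidAlgebra.single (m : ℤ) 1).coeff k := by
    intro u hu
    rw [Finset.mem_range] at hu
    have := hprob u
    have := hprob (m - u)
    rw [measureReal_def, Measure.map_apply (measurable_of_countable _) (.singleton k),
      show (fun x => x + (m : ℤ)) ⁻¹' {k} = {k - m} by
        ext; exact eq_sub_iff_add_eq.symm,
      ← measureReal_def, measureReal_mconvZ (ih u hu) (ih (m - u) (by omega)),
      AddMonoidAlgebra.coeff_mul_single_eq_coeff_mul (m := (m : ℤ)) (k - m)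
        (fun _ _ => eq_sub_iff_add_eq.symm), mul_one]
  have hreindex : μ (m + 1) = ((m + 1 : ℕ) : ENNReal)⁻¹ • ∑ u ∈ Finset.range (m + 1),
      Measure.map (fun x => x + (m : ℤ)) (mconvZ (μ u) (μ (m - u))) := by
    rw [hrec (m + 1) (by omega), ← Finset.Ico_add_one_right_eq_Icc, Finset.sum_Ico_eq_sum_range]
    congr 1
    refine Finset.sum_congr (by simp) fun u _ => ?_
    rw [Nat.add_sub_cancel_left, show m + 1 - (1 + u) = m - u by omega]
    simp
  have := hprob (m + 1)
  rw [tossCoins_coinLaw_succ hm, AddMonoidAlgebra.coeff_smul_apply, AddMonoidAlgebra.coeff_sum,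
    Finsupp.finsetSum_apply, hreindex, measureReal_def, Measure.smul_apply,
    Measure.finsetSum_apply, smul_eq_mul, ENNReal.toReal_mul, ENNReal.toReal_sum]
  · rw [smul_eq_mul, ENNReal.toReal_inv, ENNReal.toReal_natCast]
    congr 1
    exact Finset.sum_congr rfl hfin
  · intro u hu
    have := hprob u
    have := hprob (m - u)
    have : IsProbabilityMeasure (mconvZ (μ u) (μ (m - u))) :=
      isProbabilityMeasure_bind (measurable_of_countable _).aemeasurable
        (.of_forall fun x =>
          Measure.isProbabilityMeasure_map (measurable_of_countable _).aemeasurable)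
    have := Measure.isProbabilityMeasure_map (μ := mconvZ (μ u) (μ (m - u)))
      (measurable_of_countable fun x => x + (m : ℤ)).aemeasurable
    exact measure_ne_top _ _

lemma coeff_mul_nonneg {x y : AddMonoidAlgebra ℝ (ℕ × ℤ)} (hx : ∀ i, 0 ≤ x.coeff i)
    (hy : ∀ i, 0 ≤ y.coeff i) (i : ℕ × ℤ) : 0 ≤ (x * y).coeff i := by
  rw [AddMonoidAlgebra.coeff_mul]
  refine Finset.sum_nonneg fun a _ => Finset.sum_nonneg fun b _ => ?_
  dsimp only
  split_ifs
  · exact mul_nonneg (hx a) (hy b)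
  · exact le_rfl

lemma coeff_coinLaw_nonneg (n : ℕ) (i : ℕ × ℤ) : 0 ≤ (coinLaw n).coeff i := by
  have hs : ∀ (j : ℕ × ℤ) (w : ℝ), 0 ≤ w → ∀ i, 0 ≤ (AddMonoidAlgebra.single j w).coeff i := by
    intro j w hw i
    rw [AddMonoidAlgebra.coeff_single, Finsupp.single_apply]
    split_ifs <;> simp [hw]
  induction n using Nat.strong_induction_on generalizing i with
  | _ n ih =>
  rcases (by omega : n = 0 ∨ n = 1 ∨ n = 2 ∨ n = 3 ∨ (3 ≤ n - 1 ∧ n = n - 1 + 1)) with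
    rfl | rfl | rfl | rfl | ⟨h, hn⟩
  · rw [coinLaw, AddMonoidAlgebra.one_def]
    exact hs _ _ zero_le_one _
  · rw [coinLaw, AddMonoidAlgebra.one_def]
    exact hs _ _ zero_le_one _
  · rw [coinLaw]
    exact hs _ _ zero_le_one _
  · rw [coinLaw]
    exact add_nonneg (hs _ _ (by norm_num) _) (hs _ _ (by norm_num) _)
  · obtain ⟨m, rfl⟩ : ∃ m, n = m + 1 := ⟨_, hn⟩
    rw [Nat.add_sub_cancel] at h
    rw [coinLaw_succ h, AddMonoidAlgebra.coeff_smul_apply, AddMonoidAlgebra.coeff_sum,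
      Finsupp.finsetSum_apply]
    refine smul_nonneg (by positivity) (Finset.sum_nonneg fun u hu => ?_)
    rw [Finset.mem_range] at hu
    exact coeff_mul_nonneg (hs _ _ zero_le_one)
      (coeff_mul_nonneg (ih u hu) (ih (m - u) (by omega))) _

/-- At most `n` coins are used. -/
lemma fst_le_of_coeff_coinLaw_ne_zero {n : ℕ} {i : ℕ × ℤ} (hi : (coinLaw n).coeff i ≠ 0) :
    i.1 ≤ n := by
  have hs : ∀ {j : ℕ × ℤ} {w : ℝ} {i}, (AddMonoidAlgebra.single j w).coeff i ≠ 0 → i = j := by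
    intro j w i h
    rw [AddMonoidAlgebra.coeff_single, Finsupp.single_apply] at h
    by_contra h'
    exact h (if_neg (Ne.symm h'))
  have hm : ∀ {x y : AddMonoidAlgebra ℝ (ℕ × ℤ)} {i}, (x * y).coeff i ≠ 0 →
      ∃ a b, x.coeff a ≠ 0 ∧ y.coeff b ≠ 0 ∧ a + b = i := by
    intro x y i h
    have := AddMonoidAlgebra.support_coeff_mul_subset x y (Finsupp.mem_support_iff.2 h)
    obtain ⟨a, ha, b, hb, h⟩ := Finset.mem_add.1 this
    exact ⟨a, b, Finsupp.mem_support_iff.1 ha, Finsupp.mem_support_iff.1 hb, h⟩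
  induction n using Nat.strong_induction_on generalizing i with
  | _ n ih =>
  rcases (by omega : n = 0 ∨ n = 1 ∨ n = 2 ∨ n = 3 ∨ (3 ≤ n - 1 ∧ n = n - 1 + 1)) with
    rfl | rfl | rfl | rfl | ⟨h, hn⟩
  · rw [coinLaw, AddMonoidAlgebra.one_def] at hi
    simp [hs hi]
  · rw [coinLaw, AddMonoidAlgebra.one_def] at hi
    simp [hs hi]
  · rw [coinLaw] at hi
    simp [hs hi]
  · rw [coinLaw, AddMonoidAlgebra.coeff_add, Finsupp.add_apply] at hi
    by_contra hlt
    refine hi ?_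
    rw [not_not.1 (mt hs (by rintro rfl; simp at hlt)),
      not_not.1 (mt hs (by rintro rfl; simp at hlt)), add_zero]
  · obtain ⟨m, rfl⟩ : ∃ m, n = m + 1 := ⟨_, hn⟩
    rw [Nat.add_sub_cancel] at h
    rw [coinLaw_succ h, AddMonoidAlgebra.coeff_smul_apply, AddMonoidAlgebra.coeff_sum,
      Finsupp.finsetSum_apply] at hi
    obtain ⟨u, hu, hne⟩ := Finset.exists_ne_zero_of_sum_ne_zero (right_ne_zero_of_smul hi)
    rw [Finset.mem_range] at hu
    obtain ⟨a, b, ha, hb, rfl⟩ := hm hne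
    obtain ⟨c, d, hc, hd, rfl⟩ := hm hb
    have h1 := ih u hu hc
    have h2 := ih (m - u) (by omega) hd
    rw [hs ha, Prod.fst_add, Prod.fst_add]
    dsimp only
    omega

/-- The generating function of the number of coins, evaluated at `1 / 2`. -/
noncomputable def halfWeight : AddMonoidAlgebra ℝ (ℕ × ℤ) →ₐ[ℝ] ℝ :=
  AddMonoidAlgebra.lift ℝ ℝ (ℕ × ℤ)
    { toFun := fun x => (1 / 2) ^ x.toAdd.1
      map_one' := by simp
      map_mul' := fun x y => by rw [toAdd_mul, Prod.fst_add, pow_add] }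

lemma halfWeight_single (N : ℕ) (r : ℤ) (w : ℝ) :
    halfWeight (AddMonoidAlgebra.single (N, r) w) = w * (1 / 2) ^ N := by
  rw [halfWeight, AddMonoidAlgebra.lift_single]
  rfl

lemma halfWeight_eq_sum (W : AddMonoidAlgebra ℝ (ℕ × ℤ)) :
    halfWeight W = ∑ i ∈ W.coeff.support, W.coeff i * (1 / 2) ^ i.1 := by
  rw [halfWeight, AddMonoidAlgebra.lift_apply]
  rfl

/-- A comparison sequence for the quicksort recursion, equal to `1` from `4` on and of average `1`
before. -/
noncomputable def smallSlack : ℕ → ℝ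
  | 0 => 105 / 100
  | 1 => 107 / 100
  | 2 => 110 / 100
  | 3 => 78 / 100
  | _ + 4 => 1

lemma smallSlack_of_le {k : ℕ} (hk : 4 ≤ k) : smallSlack k = 1 := by
  obtain ⟨k, rfl⟩ := Nat.exists_eq_add_of_le' hk
  rfl

lemma smallSlack_nonneg (k : ℕ) : 0 ≤ smallSlack k := by
  unfold smallSlack
  split <;> norm_num

lemma sum_smallSlack {k : ℕ} (hk : 4 ≤ k) : ∑ u ∈ Finset.range k, smallSlack u = k := by
  induction k, hk using Nat.le_induction with
  | base => norm_num [Finset.sum_range_succ, smallSlack]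
  | succ k hk ih => rw [Finset.sum_range_succ, ih, smallSlack_of_le hk]; push_cast; ring

lemma quicksort_recursion_decay {φ : ℕ → ℝ} (h0 : φ 0 = 1) (h1 : φ 1 = 1) (h2 : φ 2 = 1)
    (h3 : φ 3 = 2 / 3) (hφ : ∀ n, 0 ≤ φ n)
    (hrec : ∀ n, 3 ≤ n → φ (n + 1) =
      ((n + 1 : ℕ) : ℝ)⁻¹ * ∑ u ∈ Finset.range (n + 1), φ u * φ (n - u)) (n : ℕ) :
    φ n ≤ (97 / 100) ^ (n + 1) * smallSlack n := by
  have h4 : φ 4 = 5 / 6 := by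
    rw [hrec 3 le_rfl]; norm_num [Finset.sum_range_succ, h0, h1, h2, h3]
  have h5 : φ 5 = 4 / 5 := by
    rw [hrec 4 (by norm_num)]; norm_num [Finset.sum_range_succ, h0, h1, h2, h3, h4]
  have h6 : φ 6 = 23 / 30 := by
    rw [hrec 5 (by norm_num)]; norm_num [Finset.sum_range_succ, h0, h1, h2, h3, h4, h5]
  have h7 : φ 7 = 236 / 315 := by
    rw [hrec 6 (by norm_num)]; norm_num [Finset.sum_range_succ, h0, h1, h2, h3, h4, h5, h6]
  induction n using Nat.strong_induction_on with
  | _ n ih =>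
  rcases lt_or_ge n 8 with hn | hn
  · interval_cases n <;> norm_num [smallSlack, h0, h1, h2, h3, h4, h5, h6, h7]
  obtain ⟨m, rfl⟩ : ∃ m, n = m + 1 := ⟨n - 1, by omega⟩
  have hm0 : (0 : ℝ) < (m + 1 : ℕ) := by positivity
  have term : ∀ u ∈ Finset.range (m + 1), φ u * φ (m - u) ≤
      (97 / 100) ^ (m + 2) * (smallSlack u + smallSlack (m - u) - 1) := by
    intro u hu
    rw [Finset.mem_range] at hu
    have hs : smallSlack u + smallSlack (m - u) - 1 = smallSlack u * smallSlack (m - u) := by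
      rcases (by omega : 4 ≤ u ∨ 4 ≤ m - u) with h | h <;> rw [smallSlack_of_le h] <;> ring
    rw [hs]
    calc φ u * φ (m - u) ≤ ((97 / 100) ^ (u + 1) * smallSlack u) *
          ((97 / 100) ^ (m - u + 1) * smallSlack (m - u)) :=
          mul_le_mul (ih u hu) (ih (m - u) (by omega)) (hφ _)
            (mul_nonneg (by positivity) (smallSlack_nonneg u))
      _ = (97 / 100) ^ ((u + 1) + (m - u + 1)) * (smallSlack u * smallSlack (m - u)) := by
          rw [pow_add]; ring
      _ = _ := by rw [show (u + 1) + (m - u + 1) = m + 2 by omega]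
  rw [hrec m (by omega), smallSlack_of_le (by omega), inv_mul_le_iff₀ hm0]
  refine (Finset.sum_le_sum term).trans_eq ?_
  have hr := Finset.sum_range_reflect smallSlack (m + 1)
  simp only [Nat.add_sub_cancel] at hr
  rw [← Finset.mul_sum, Finset.sum_sub_distrib, Finset.sum_add_distrib, hr,
    sum_smallSlack (by omega)]
  simp
  ring

lemma halfWeight_coinLaw_le {n : ℕ} (hn : 4 ≤ n) :
    halfWeight (coinLaw n) ≤ (97 / 100) ^ (n + 1) := by
  have h := quicksort_recursion_decay (φ := fun n => halfWeight (coinLaw n))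
    (by rw [coinLaw, map_one]) (by rw [coinLaw, map_one])
    (by rw [coinLaw, halfWeight_single]; norm_num)
    (by rw [coinLaw, map_add, halfWeight_single, halfWeight_single]; norm_num)
    (fun n => by
      rw [halfWeight_eq_sum]
      exact Finset.sum_nonneg fun i _ => mul_nonneg (coeff_coinLaw_nonneg n i) (by positivity))
    (fun n hn => by
      rw [coinLaw_succ hn, map_smul, map_sum, smul_eq_mul]
      congr 1
      refine Finset.sum_congr rfl fun u _ => ?_
      rw [map_mul, map_mul, halfWeight_single]
      ring) n
  rwa [smallSlack_of_le hn, mul_one] at h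

/-- With overwhelming probability there are at least `n / 50` coins. -/
lemma few_coins_le {n : ℕ} (hn : 4 ≤ n) :
    ∑ i ∈ (coinLaw n).coeff.support with (i.1 : ℝ) < n / 50, (coinLaw n).coeff i ≤
      Real.exp (-(n / 200)) := by
  have hlog2 : (2 : ℝ) ≤ Real.exp (7 / 10) := by
    rw [← Real.log_le_iff_le_exp (by norm_num)]
    linarith [Real.log_two_lt_d9]
  have step : ∀ i ∈ {i ∈ (coinLaw n).coeff.support | (i.1 : ℝ) < n / 50},
      (coinLaw n).coeff i ≤
        Real.exp (7 / 500 * n) * ((coinLaw n).coeff i * (1 / 2) ^ i.1) := by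
    intro i hi
    rw [Finset.mem_filter] at hi
    have h0 := coeff_coinLaw_nonneg n i
    have h1 : (2 : ℝ) ^ i.1 ≤ Real.exp (7 / 500 * n) := by
      calc (2 : ℝ) ^ i.1 ≤ Real.exp (7 / 10) ^ i.1 := by gcongr
        _ = Real.exp (7 / 10 * i.1) := by rw [← Real.exp_nat_mul]; ring_nf
        _ ≤ _ := Real.exp_le_exp.2 (by linarith [hi.2])
    have h2 : (1 : ℝ) ≤ Real.exp (7 / 500 * n) * (1 / 2) ^ i.1 := by
      rw [one_div, inv_pow, ← div_eq_mul_inv, one_le_div (by positivity)]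
      exact h1
    calc (coinLaw n).coeff i ≤ (coinLaw n).coeff i * (Real.exp (7 / 500 * n) * (1 / 2) ^ i.1) :=
          le_mul_of_one_le_right h0 h2
      _ = _ := by ring
  calc _ ≤ ∑ i ∈ (coinLaw n).coeff.support with (i.1 : ℝ) < n / 50,
        Real.exp (7 / 500 * n) * ((coinLaw n).coeff i * (1 / 2) ^ i.1) := Finset.sum_le_sum step
    _ ≤ ∑ i ∈ (coinLaw n).coeff.support,
        Real.exp (7 / 500 * n) * ((coinLaw n).coeff i * (1 / 2) ^ i.1) :=
        Finset.sum_le_sum_of_subset_of_nonneg (Finset.filter_subset _ _) fun i _ _ =>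
          mul_nonneg (Real.exp_pos _).le
            (mul_nonneg (coeff_coinLaw_nonneg n i) (by positivity))
    _ = Real.exp (7 / 500 * n) * halfWeight (coinLaw n) := by
        rw [halfWeight_eq_sum, Finset.mul_sum]
    _ ≤ Real.exp (7 / 500 * n) * Real.exp (-(3 / 100)) ^ (n + 1) := by
        have := Real.add_one_le_exp (-(3 / 100) : ℝ)
        refine mul_le_mul_of_nonneg_left ((halfWeight_coinLaw_le hn).trans ?_) (Real.exp_pos _).le
        gcongr
        linarith
    _ = Real.exp (7 / 500 * n + (n + 1 : ℕ) * -(3 / 100)) := by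
        rw [← Real.exp_nat_mul, ← Real.exp_add]
    _ ≤ _ := by
        gcongr
        push_cast
        have : (0 : ℝ) ≤ n := Nat.cast_nonneg n
        linarith

lemma quicksortLaw_smooth {μ : ℕ → Measure ℤ} (hμ : IsQuicksortLaw μ) {n s : ℕ} {m l : ℝ}
    (hn : 1000000 ≤ n) (hm : 1 ≤ m) (hl : 1 ≤ l) (hlm : l * m ≤ √n) (hln : l ≤ √n / 4000)
    (hs1 : l * √n ≤ s) (hs2 : s ≤ 4 * (l * √n)) {t : ℤ} (ht : |(t : ℝ)| ≤ m) (k : ℤ) :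
    (μ n).real {k} ≤ Real.exp (3000 * (l * m / √n)) * (μ n).real {k + t} +
      Real.exp (-l ^ 2) * ((μ n).real {k - s} + (μ n).real {k + s}) + Real.exp (-(n / 200)) := by
  refine le_trans ?_ (add_le_add_right (few_coins_le (n := n) (by omega)) _)
  simp only [measureReal_quicksortLaw hμ, coeff_tossCoins]
  rw [Finset.sum_filter, ← Finset.sum_add_distrib, Finset.mul_sum, Finset.mul_sum,
    ← Finset.sum_add_distrib, ← Finset.sum_add_distrib]
  refine Finset.sum_le_sum fun i hi => ?_
  have hw := coeff_coinLaw_nonneg n i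
  have b0 := fairBinom_nonneg i.1
  split_ifs with h
  · have h1 := mul_le_of_le_one_right hw (fairBinom_le_one i.1 (k - i.2))
    refine h1.trans (le_add_of_nonneg_left ?_)
    have := b0 (k + t - i.2)
    have := b0 (k - s - i.2)
    have := b0 (k + s - i.2)
    positivity
  · have hb := fairBinom_smooth hn (fst_le_of_coeff_coinLaw_ne_zero (Finsupp.mem_support_iff.1 hi))
      (not_lt.1 h) hm hl hlm hln hs1 hs2 ht (k - i.2)
    rw [show k - i.2 + t = k + t - i.2 by ring, show k - i.2 - s = k - s - i.2 by ring,
      show k - i.2 + s = k + s - i.2 by ring] at hb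
    refine (mul_le_mul_of_nonneg_left hb hw).trans_eq ?_
    ring

lemma setOf_mem_Ioc_eq (a b : ℝ) :
    {k : ℤ | (k : ℝ) ∈ Set.Ioc a b} = (Finset.Ioc ⌊a⌋ ⌊b⌋ : Finset ℤ) := by
  ext k
  simp [Int.floor_lt, Int.le_floor]

lemma measureReal_intCast_Ioc (ν : Measure ℤ) [IsProbabilityMeasure ν] (a b : ℝ) :
    (ν {k : ℤ | (k : ℝ) ∈ Set.Ioc a b}).toReal = ∑ k ∈ Finset.Ioc ⌊a⌋ ⌊b⌋, ν.real {k} := by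
  rw [setOf_mem_Ioc_eq, ← measureReal_def, sum_measureReal_singleton]

/-- A half-open interval of length `m` with integral right end contains `⌈m⌉` integers. -/
lemma measureReal_Ioc_right (ν : Measure ℤ) [IsProbabilityMeasure ν] (z : ℤ) {m : ℝ} (hm : 0 ≤ m) :
    (ν {k : ℤ | (k : ℝ) ∈ Set.Ioc (z - m) (z - m + m)}).toReal =
      ∑ i ∈ Finset.range ⌈m⌉₊, ν.real {z - (i : ℤ)} := by
  rw [measureReal_intCast_Ioc, sub_add_cancel, Int.floor_intCast, sub_eq_add_neg,
    Int.floor_intCast_add, Int.floor_neg, ← Int.natCast_ceil_eq_ceil hm]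
  symm
  refine Finset.sum_bij (fun i _ => z - (i : ℤ)) ?_ ?_ ?_ (fun _ _ => rfl)
  · intro i hi
    rw [Finset.mem_range] at hi
    rw [Finset.mem_Ioc]
    omega
  · intro i _ j _ h
    omega
  · intro k hk
    rw [Finset.mem_Ioc] at hk
    exact ⟨(z - k).toNat, Finset.mem_range.2 (by omega), by omega⟩

/-- A half-open interval of length `m` with integral left end contains `⌊m⌋` integers. -/
lemma measureReal_Ioc_left (ν : Measure ℤ) [IsProbabilityMeasure ν] (z : ℤ) {m : ℝ} (hm : 0 ≤ m) :
    (ν {k : ℤ | (k : ℝ) ∈ Set.Ioc (z - 1 : ℝ) (z - 1 + m)}).toReal =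
      ∑ i ∈ Finset.range ⌊m⌋₊, ν.real {z + (i : ℤ)} := by
  rw [measureReal_intCast_Ioc, show (z : ℝ) - 1 = ((z - 1 : ℤ) : ℝ) by push_cast; ring,
    Int.floor_intCast, Int.floor_intCast_add, ← Int.natCast_floor_eq_floor hm]
  symm
  refine Finset.sum_bij (fun i _ => z + (i : ℤ)) ?_ ?_ ?_ (fun _ _ => rfl)
  · intro i hi
    rw [Finset.mem_range] at hi
    rw [Finset.mem_Ioc]
    omega
  · intro i _ j _ h
    omega
  · intro k hk
    rw [Finset.mem_Ioc] at hk
    exact ⟨(k - z).toNat, Finset.mem_range.2 (by omega), by omega⟩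

lemma exists_le_of_sum_le {g : ℕ → ℝ} {m B : ℝ} (hm : 0 < m) (hg : ∀ i, 0 ≤ g i)
    (h : ∑ i ∈ Finset.range ⌈m⌉₊, g i ≤ B * m) : ∃ i < ⌈m⌉₊, g i ≤ B := by
  by_contra! hlt
  have hB : 0 ≤ B :=
    nonneg_of_mul_nonneg_left ((Finset.sum_nonneg fun i _ => hg i).trans h) hm
  have h1 : ∑ _i ∈ Finset.range ⌈m⌉₊, B < ∑ i ∈ Finset.range ⌈m⌉₊, g i :=
    Finset.sum_lt_sum_of_nonempty (Finset.nonempty_range_iff.2 (Nat.ceil_pos.2 hm).ne')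
      fun i hi => hlt i (Finset.mem_range.1 hi)
  rw [Finset.sum_const, Finset.card_range, nsmul_eq_mul] at h1
  nlinarith [Nat.le_ceil m]

/-- If all point masses within distance `m` of a point of mass at most `Γ / n` are larger by at
most `δ`, then the smoothness at scale `m` passes to scale `1`. -/
lemma Sprop.one_of_smooth {ν : Measure ℤ} [IsProbabilityMeasure ν] {q : ℝ} {n : ℕ} {f : ℝ → ℝ}
    {m ε Γ δ : ℝ} (hn : 0 < n) (hm : 1 ≤ m) (hδ : 0 ≤ δ) (hS : Sprop ν q n f m ε Γ)
    (hsm : ∀ k k' : ℤ, |(k' - k : ℝ)| ≤ m → ν.real {k'} ≤ Γ / n →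
      ν.real {k} ≤ ν.real {k'} + δ / n) :
    Sprop ν q n f 1 (ε + δ) (Γ + δ) := by
  obtain ⟨h1, h2⟩ := hS
  have hm0 : 0 < m := by linarith
  have hn' : (0 : ℝ) < n := by exact_mod_cast hn
  have single : ∀ a : ℝ, (ν {k : ℤ | (k : ℝ) ∈ Set.Ioc a (a + 1)}).toReal = ν.real {⌊a⌋ + 1} := by
    intro a
    rw [measureReal_intCast_Ioc, Int.floor_add_one]
    have h : Finset.Ioc ⌊a⌋ (⌊a⌋ + 1) = {⌊a⌋ + 1} := by
      ext k
      rw [Finset.mem_Ioc, Finset.mem_singleton]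
      omega
    rw [h, Finset.sum_singleton]
  have ceil_lt : ∀ i < ⌈m⌉₊, (i : ℝ) < m := fun i hi => Nat.lt_ceil.1 hi
  constructor
  · intro a x hx
    rw [single]
    set k := ⌊a⌋ + 1
    set y := q + n * x
    set z := ⌈y⌉
    have hzy : y ≤ z := Int.le_ceil y
    have hzy' : (z : ℝ) < y + 1 := Int.ceil_lt_add_one y
    have hk1 : (k : ℝ) ≤ a + 1 := by
      have := Int.floor_le a
      push_cast [k]
      linarith
    have hk2 : a < k := by
      push_cast [k]
      exact Int.lt_floor_add_one a
    have hkz : k ≤ z := by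
      have h : (k : ℝ) < (z + 1 : ℤ) := by push_cast; linarith [hx.1]
      exact Int.lt_add_one_iff.1 (Int.cast_lt.1 h)
    have hzk : z ≤ k + 1 := by
      have h : (z : ℝ) < (k + 1 + 1 : ℤ) := by push_cast; linarith [hx.2]
      exact Int.lt_add_one_iff.1 (Int.cast_lt.1 h)
    have hkz' : (k : ℝ) ≤ z := by exact_mod_cast hkz
    have hzk' : (z : ℝ) ≤ k + 1 := by exact_mod_cast hzk
    rw [abs_le]
    constructor
    · have hJ : y ∈ Set.Ioc (z - 1 : ℝ) (z - 1 + m) := ⟨by linarith, by linarith⟩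
      have hlow := (abs_le.1 (h1 _ x hJ)).1
      have hup := h2 (z - 1 : ℝ)
      rw [measureReal_Ioc_left ν z hm0.le] at hlow hup
      suffices h : (f x - ε) / n ≤ ν.real {k} + δ / n by
        have e : 1 / n * f x - (ε + δ) * 1 / n = (f x - ε) / n - δ / n := by ring
        linarith
      have hlow' : m * ((f x - ε) / n) ≤ ∑ i ∈ Finset.range ⌊m⌋₊, ν.real {z + (i : ℤ)} := by
        have e : m * ((f x - ε) / n) = m / n * f x - ε * m / n := by ring
        linarith
      have hd : 0 ≤ δ / n := by positivity
      rcases le_total (Γ / n) (ν.real {k}) with hc | hc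
      · refine le_of_mul_le_mul_left (hlow'.trans (hup.trans ?_)) hm0
        calc Γ * m / n = m * (Γ / n) := by ring
          _ ≤ _ := by gcongr; linarith
      · have hv : 0 ≤ ν.real {k} + δ / n := by positivity
        refine le_of_mul_le_mul_left (hlow'.trans ?_) hm0
        calc _ ≤ ∑ _i ∈ Finset.range ⌊m⌋₊, (ν.real {k} + δ / n) := by
              refine Finset.sum_le_sum fun i hi => hsm _ _ ?_ hc
              have hi' : (i : ℝ) + 1 ≤ m := by
                have : i + 1 ≤ ⌊m⌋₊ := Finset.mem_range.1 hi
                exact_mod_cast (Nat.le_floor_iff hm0.le).1 this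
              have : (0 : ℝ) ≤ i := Nat.cast_nonneg i
              push_cast
              rw [abs_le]
              constructor <;> linarith
          _ = ⌊m⌋₊ * (ν.real {k} + δ / n) := by
              rw [Finset.sum_const, Finset.card_range, nsmul_eq_mul]
          _ ≤ _ := by gcongr; exact Nat.floor_le hm0.le
    · have hJ : y ∈ Set.Ioc (z - m : ℝ) (z - m + m) := ⟨by linarith, by linarith⟩
      have hup := (abs_le.1 (h1 _ x hJ)).2
      have hup' := h2 (z - m : ℝ)
      rw [measureReal_Ioc_right ν z hm0.le] at hup hup'
      obtain ⟨i, hi, hiB⟩ := exists_le_of_sum_le (B := min (Γ / n) ((f x + ε) / n)) hm0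
        (fun i => measureReal_nonneg (μ := ν) (s := {z - (i : ℤ)})) (by
          rw [min_mul_of_nonneg _ _ hm0.le, le_min_iff]
          constructor
          · calc _ ≤ _ := hup'
              _ = _ := by ring
          · have e : (f x + ε) / n * m = m / n * f x + ε * m / n := by ring
            linarith)
      obtain ⟨hi1, hi2⟩ := le_min_iff.1 hiB
      have := hsm k (z - i) (by
        have := ceil_lt i hi
        have : (0 : ℝ) ≤ i := Nat.cast_nonneg i
        push_cast
        rw [abs_le]
        constructor <;> linarith) hi1
      have e : 1 / n * f x + (ε + δ) * 1 / n = (f x + ε) / n + δ / n := by ring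
      linarith
  · intro a
    rw [single]
    set k := ⌊a⌋ + 1
    have hup := h2 (k - m : ℝ)
    rw [measureReal_Ioc_right ν k hm0.le] at hup
    obtain ⟨i, hi, hiB⟩ := exists_le_of_sum_le (B := Γ / n) hm0
      (fun i => measureReal_nonneg (μ := ν) (s := {k - (i : ℤ)}))
      (hup.trans_eq (by ring))
    have := hsm k (k - i) (by
      have := ceil_lt i hi
      have : (0 : ℝ) ≤ i := Nat.cast_nonneg i
      push_cast
      rw [abs_le]
      constructor <;> linarith) hiB
    have e : (Γ + δ) * 1 / n = Γ / n + δ / n := by ring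
    linarith

lemma Sprop.mono {ν : Measure ℤ} {q : ℝ} {n : ℕ} {f : ℝ → ℝ} {m ε Γ ε' Γ' : ℝ} (hm : 0 ≤ m)
    (hε : ε ≤ ε') (hΓ : Γ ≤ Γ') (h : Sprop ν q n f m ε Γ) : Sprop ν q n f m ε' Γ' :=
  ⟨fun a x hx => (h.1 a x hx).trans (by gcongr), fun a => (h.2 a).trans (by gcongr)⟩

/-- Averaging over the shift in the tail terms of `quicksortLaw_smooth`. -/
lemma quicksortLaw_smooth_of_Sprop {μ : ℕ → Measure ℤ} (hμ : IsQuicksortLaw μ) {n : ℕ}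
    {f : ℝ → ℝ} {m l ε Γ q : ℝ} (hn : 1000000 ≤ n) (hm : 1 ≤ m) (hl : 1 ≤ l) (hlm : l * m ≤ √n)
    (hln : l ≤ √n / 4000) (hS : Sprop (μ n) q n f m ε Γ) {t : ℤ} (ht : |(t : ℝ)| ≤ m) (k : ℤ) :
    (μ n).real {k} ≤ Real.exp (3000 * (l * m / √n)) * (μ n).real {k + t} +
      Real.exp (-l ^ 2) * (2 * (Γ / n)) + Real.exp (-(n / 200)) := by
  have := hμ.1 n
  have hm0 : 0 < m := by linarith
  set s₀ := ⌈l * √n⌉₊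
  set M := ⌈m⌉₊
  have hM : 0 < M := Nat.ceil_pos.2 hm0
  have h1 := hS.2 ((k - s₀ : ℤ) - m)
  have h2 := hS.2 ((k + s₀ + M - 1 : ℤ) - m)
  rw [measureReal_Ioc_right _ _ hm0.le] at h1 h2
  rw [← Finset.sum_range_reflect] at h2
  obtain ⟨i, hi, hiB⟩ := exists_le_of_sum_le (B := 2 * (Γ / n)) hm0
    (g := fun i => (μ n).real {k - (s₀ + i : ℕ)} + (μ n).real {k + (s₀ + i : ℕ)})
    (fun i => by positivity) (by
      rw [Finset.sum_add_distrib]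
      have e1 : ∑ i ∈ Finset.range M, (μ n).real {k - (s₀ + i : ℕ)} =
          ∑ i ∈ Finset.range M, (μ n).real {k - s₀ - (i : ℤ)} := by
        refine Finset.sum_congr rfl fun i _ => ?_
        congr 2
        push_cast
        ring
      have e2 : ∑ i ∈ Finset.range M, (μ n).real {k + (s₀ + i : ℕ)} =
          ∑ i ∈ Finset.range M, (μ n).real {k + s₀ + M - 1 - ((M - 1 - i : ℕ) : ℤ)} := by
        refine Finset.sum_congr rfl fun i hi => ?_
        rw [Finset.mem_range] at hi
        congr 2
        omega
      rw [e1, e2]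
      calc _ ≤ Γ * m / n + Γ * m / n := add_le_add h1 h2
        _ = _ := by ring)
  have hq : 1000 ≤ √(n : ℝ) := by
    apply Real.le_sqrt_of_sq_le
    norm_num
    exact_mod_cast hn
  have hs1 : l * √n ≤ s₀ := Nat.le_ceil _
  have hs2 : (s₀ : ℝ) < l * √n + 1 := Nat.ceil_lt_add_one (by positivity)
  have him : (i : ℝ) < m := Nat.lt_ceil.1 hi
  have hlq : √(n : ℝ) ≤ l * √n := le_mul_of_one_le_left (by positivity) hl
  have hml : m ≤ l * m := le_mul_of_one_le_left hm0.le hl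
  have hi0 : (0 : ℝ) ≤ i := Nat.cast_nonneg i
  refine (quicksortLaw_smooth hμ hn hm hl hlm hln (s := s₀ + i) (by push_cast; linarith)
    (by push_cast; linarith) ht k).trans ?_
  gcongr

/-- **The final (binomial) smoothing lemma.**  There are constants `n₀`, `c > 0` and `C`
such that: if `n ≥ n₀`, `m ≥ 1` and `λ ≥ 1` satisfy `λm ≤ √n` and `λ ≤ c√n/20`, and
`S(n, m, ε, Γ)` holds, then `S(n, 1, ε', Γ')` holds for every `ε' ≥ ε + Γη` and every
`Γ' ≥ Γ(1 + η)`, where `η = C(e^{−cλ²} + λm/√n + n e^{−cn})`. -/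
theorem core_smoothing_binomial
    (μ : ℕ → Measure ℤ) (hμ : IsQuicksortLaw μ) :
    ∃ (n₀ : ℕ) (c C : ℝ), 0 < c ∧
      ∀ (f : ℝ → ℝ) (n : ℕ), n₀ ≤ n → ∀ m lam : ℝ, 1 ≤ m → 1 ≤ lam →
        lam * m ≤ Real.sqrt n → lam ≤ c * Real.sqrt n / 20 →
        ∀ ε Γ : ℝ, 0 < ε → 1 ≤ Γ →
        Sprop (μ n) (meanZ (μ n)) n f m ε Γ →
        ∀ ε' Γ' : ℝ,
          ε + Γ * (C * (Real.exp (-c * lam ^ 2) + lam * m / Real.sqrt n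
              + (n : ℝ) * Real.exp (-c * n))) ≤ ε' →
          Γ * (1 + C * (Real.exp (-c * lam ^ 2) + lam * m / Real.sqrt n
              + (n : ℝ) * Real.exp (-c * n))) ≤ Γ' →
          Sprop (μ n) (meanZ (μ n)) n f 1 ε' Γ' := by
  refine ⟨1000000, 1 / 200, 3000 * Real.exp 3000 + 2, by norm_num, ?_⟩
  intro f n hn m lam hm hl hlm hln ε Γ _ hΓ hS ε' Γ' hε' hΓ'
  have := hμ.1 n
  have hn0 : 0 < n := by omega
  have hn' : (0 : ℝ) < n := by exact_mod_cast hn0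
  have hsq : 0 < √(n : ℝ) := Real.sqrt_pos.2 hn'
  set x := lam * m / √(n : ℝ)
  have hx0 : 0 ≤ x := by positivity
  have hx1 : x ≤ 1 := (div_le_one hsq).2 hlm
  set η := (3000 * Real.exp 3000 + 2) *
    (Real.exp (-(1 / 200) * lam ^ 2) + x + n * Real.exp (-(1 / 200) * n)) with hη
  refine (Sprop.one_of_smooth (δ := Γ * η) hn0 hm (by positivity) hS ?_).mono
    zero_le_one hε' (by linarith)
  intro k k' hkk hk'
  have hmain := quicksortLaw_smooth_of_Sprop hμ hn hm hl hlm (by linarith) hS (t := k' - k)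
    (by push_cast; exact hkk) k
  rw [add_sub_cancel] at hmain
  have hexp : Real.exp (3000 * x) ≤ 1 + 3000 * Real.exp 3000 * x := by
    have h1 := Real.add_one_le_exp (-(3000 * x))
    have h2 : Real.exp (3000 * x) * Real.exp (-(3000 * x)) = 1 := by
      rw [← Real.exp_add, add_neg_cancel, Real.exp_zero]
    have h3 : Real.exp (3000 * x) ≤ Real.exp 3000 := Real.exp_le_exp.2 (by linarith)
    have h4 := Real.exp_pos (3000 * x)
    nlinarith
  have htail : Real.exp (-lam ^ 2) ≤ Real.exp (-(1 / 200) * lam ^ 2) :=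
    Real.exp_le_exp.2 (by nlinarith [sq_nonneg lam])
  have hbad : Real.exp (-(n / 200 : ℝ)) ≤ Γ / n * (n * Real.exp (-(1 / 200) * n)) := by
    rw [show -(n / 200 : ℝ) = -(1 / 200) * n by ring, ← mul_assoc, div_mul_cancel₀ _ hn'.ne']
    exact le_mul_of_one_le_left (Real.exp_pos _).le hΓ
  have hG : 0 ≤ Γ / n := by positivity
  have hp : 0 ≤ (μ n).real {k'} := measureReal_nonneg
  have hK : 0 < 3000 * Real.exp 3000 := by positivity
  have hb1 : Real.exp (3000 * x) * (μ n).real {k'} ≤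
      (μ n).real {k'} + 3000 * Real.exp 3000 * x * (Γ / n) := by
    calc _ ≤ (1 + 3000 * Real.exp 3000 * x) * (μ n).real {k'} := by gcongr
      _ = (μ n).real {k'} + 3000 * Real.exp 3000 * x * (μ n).real {k'} := by ring
      _ ≤ _ := by gcongr
  have hb2 : Real.exp (-lam ^ 2) * (2 * (Γ / n)) ≤
      Real.exp (-(1 / 200) * lam ^ 2) * (2 * (Γ / n)) := by gcongr
  set A := Real.exp (-(1 / 200) * lam ^ 2)
  set B := (n : ℝ) * Real.exp (-(1 / 200) * n)
  have hA : 0 ≤ A := (Real.exp_pos _).le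
  have hB : 0 ≤ B := by positivity
  have hfin : 3000 * Real.exp 3000 * x + 2 * A + B ≤ η := by
    rw [hη]
    nlinarith [mul_nonneg hK.le hA, mul_nonneg hK.le hB]
  calc _ ≤ _ := hmain
    _ ≤ (μ n).real {k'} + Γ / n * (3000 * Real.exp 3000 * x + 2 * A + B) := by linarith
    _ ≤ (μ n).real {k'} + Γ / n * η := by gcongr
    _ = _ := by ring
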